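/- Let (V⁰, V¹, Ψ) be a fractal triple, let r ∈ (0,∞)^k, and let E be a Dirichlet form on V⁰. Then Λ_r(E) is again a Dirichlet form on V⁰; i.e., there exist coefficients c'_{p,q} ≥ 0 (for unordered pairs of distinct points p, q ∈ V⁰) such that Λ_r(E)(u) = ∑_{{p,q}} c'_{p,q} (u(p) − u(q))² for all u ∈ ℝ^{V⁰}. -/

import Mathlib

/-- A Dirichlet form on a finite set `V`, invariant with respect to an additive
constant: a functional of the form `E u = ∑_{{p,q} ⊆ V, p ≠ q} c_{p,q} (u p - u q)²`
with nonnegative coefficients (encoded via a symmetric nonnegative coefficient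
matrix, summing over ordered pairs; the diagonal terms vanish). -/
def IsDirichletForm {V : Type*} [Fintype V] (E : (V → ℝ) → ℝ) : Prop :=
  ∃ c : V → V → ℝ, (∀ p q, 0 ≤ c p q) ∧ (∀ p q, c p q = c q p) ∧
    ∀ u : V → ℝ, E u = ∑ p, ∑ q, c p q * (u p - u q) ^ 2

/-- An irreducible Dirichlet form: moreover `E u = 0` iff `u` is constant. -/
def IsIrreducibleDirichletForm {V : Type*} [Fintype V] (E : (V → ℝ) → ℝ) : Prop :=
  IsDirichletForm E ∧ ∀ u : V → ℝ, E u = 0 ↔ ∀ p q, u p = u q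

/-- The effective conductivity `C̃_{p,q}(E)` between `p` and `q`:
the minimum (here: infimum, which is attained) of `E` over
`{u : u p = 0, u q = 1}`. -/
noncomputable def effCond {V : Type*} [Fintype V] (E : (V → ℝ) → ℝ)
    (p q : V) : ℝ :=
  sInf {x : ℝ | ∃ u : V → ℝ, u p = 0 ∧ u q = 1 ∧ E u = x}

/-- A fractal triple `(V⁰, V¹, Ψ)`: `V⁰ = {P 1, …, P N}` (`N ≥ 2`) is encoded by an
injective family `P : Fin N → V1` of points of the finite set `V¹ = V1`, and
`Ψ = {ψ 1, …, ψ k}` (`k ≥ N`) is a family of one-to-one maps from `V⁰` into `V¹`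
(encoded as injective maps `Fin N → V1`) covering `V¹`, such that
(a) `ψ j (P j) = P j` for `j = 1, …, N`;
(b) `P j ∉ ψ i (V⁰)` when `i ≠ j`;
(c) any two points of `V¹` are connected by a path each edge of which lies in
    some cell `ψ i (V⁰)`. -/
structure FractalTriple (N k : ℕ) (V1 : Type*) [Fintype V1] where
  hN : 2 ≤ N
  hk : N ≤ k
  P : Fin N → V1
  P_inj : Function.Injective P
  ψ : Fin k → Fin N → V1
  ψ_inj : ∀ i, Function.Injective (ψ i)
  cover : ∀ y : V1, ∃ i j, ψ i j = y
  fixed : ∀ j : Fin N, ψ (Fin.castLE hk j) j = P j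
  sep : ∀ (i : Fin k) (j : Fin N), i ≠ Fin.castLE hk j → P j ∉ Set.range (ψ i)
  conn : ∀ y y' : V1, Relation.ReflTransGen
    (fun a b => ∃ i, a ∈ Set.range (ψ i) ∧ b ∈ Set.range (ψ i)) y y'

variable {N k : ℕ} {V1 : Type*} [Fintype V1]

/-- `S_{1,r}(E)(v) = ∑ i, r i * E (v ∘ ψ i)`. -/
noncomputable def S1r (F : FractalTriple N k V1) (r : Fin k → ℝ)
    (E : (Fin N → ℝ) → ℝ) (v : V1 → ℝ) : ℝ :=
  ∑ i, r i * E (fun j => v (F.ψ i j))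

/-- The renormalization operator:
`Λ_r(E)(u) = inf { S_{1,r}(E)(v) : v : V1 → ℝ, v = u on V⁰ }`. -/
noncomputable def Lam (F : FractalTriple N k V1) (r : Fin k → ℝ)
    (E : (Fin N → ℝ) → ℝ) (u : Fin N → ℝ) : ℝ :=
  sInf {x : ℝ | ∃ v : V1 → ℝ, (∀ j, v (F.P j) = u j) ∧ S1r F r E v = x}

/-- The quadratic form on `ℝ^W` with coefficients `c`. -/
def quadEnergy {W : Type*} [Fintype W] (c : W → W → ℝ) (u : W → ℝ) : ℝ :=
  ∑ p, ∑ q, c p q * (u p - u q) ^ 2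

/-- Completing the square for a weighted star with centre value `t`. -/
theorem star_mesh_identity {W : Type*} [Fintype W] (a u : W → ℝ) (ha : ∀ q, 0 ≤ a q) (t : ℝ) :
    2 * ∑ q, a q * (t - u q) ^ 2 =
      quadEnergy (fun p q => a p * a q / ∑ w, a w) u +
        2 * (∑ w, a w) * (t - (∑ q, a q * u q) / ∑ w, a w) ^ 2 := by
  set d := ∑ w, a w with hd
  by_cases h0 : d = 0
  · have hz : ∀ q, a q = 0 := fun q =>
      (Finset.sum_eq_zero_iff_of_nonneg fun w _ => ha w).1 (hd.symm.trans h0) q (Finset.mem_univ q)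
    simp [quadEnergy, hz, h0]
  · have hstar : ∑ q, a q * (t - u q) ^ 2 =
        d * t ^ 2 - 2 * t * (∑ q, a q * u q) + ∑ q, a q * u q ^ 2 := by
      rw [hd, Finset.sum_mul, Finset.mul_sum, ← Finset.sum_sub_distrib, ← Finset.sum_add_distrib]
      exact Finset.sum_congr rfl fun q _ => by ring
    have hmesh : quadEnergy (fun p q => a p * a q / d) u =
        2 * ∑ q, a q * u q ^ 2 - 2 * (∑ q, a q * u q) ^ 2 / d := by
      have hrow : ∀ p, ∑ q, a p * a q / d * (u p - u q) ^ 2 =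
          a p * u p ^ 2 - 2 / d * (∑ q, a q * u q) * (a p * u p)
            + a p / d * ∑ q, a q * u q ^ 2 := by
        intro p
        have hp : a p * u p ^ 2 = ∑ q, a q * (a p * u p ^ 2 / d) := by
          rw [← Finset.sum_mul, ← hd]; field_simp
        rw [hp, Finset.mul_sum, Finset.sum_mul, Finset.mul_sum, ← Finset.sum_sub_distrib,
          ← Finset.sum_add_distrib]
        exact Finset.sum_congr rfl fun q _ => by ring
      simp only [quadEnergy, hrow]
      rw [Finset.sum_add_distrib, Finset.sum_sub_distrib, ← Finset.mul_sum, ← Finset.sum_mul,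
        ← Finset.sum_div, ← hd, div_self h0]
      ring
    rw [hstar, hmesh]
    field_simp
    ring

/-- The edge weights from `s` to the other vertices. -/
def starWeight {W : Type*} [DecidableEq W] (c : W → W → ℝ) (s q : W) : ℝ :=
  if q = s then 0 else c s q

theorem starWeight_nonneg {W : Type*} [DecidableEq W] {c : W → W → ℝ}
    (h0 : ∀ p q, 0 ≤ c p q) (s q : W) : 0 ≤ starWeight c s q := by
  unfold starWeight
  split_ifs
  exacts [le_rfl, h0 s q]

/-- The coefficients obtained by eliminating the vertex `s`. -/
noncomputable def elimCoeff {W : Type*} [Fintype W] [DecidableEq W] (c : W → W → ℝ) (s : W)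
    (p q : W) : ℝ :=
  (if p = s ∨ q = s then 0 else c p q) +
    starWeight c s p * starWeight c s q / ∑ w, starWeight c s w

section Elimination

variable {W : Type*} [Fintype W] [DecidableEq W] {c : W → W → ℝ}

theorem elimCoeff_nonneg (h0 : ∀ p q, 0 ≤ c p q) (s p q : W) : 0 ≤ elimCoeff c s p q := by
  refine add_nonneg ?_ (div_nonneg (mul_nonneg (starWeight_nonneg h0 s p)
    (starWeight_nonneg h0 s q)) (Finset.sum_nonneg fun w _ => starWeight_nonneg h0 s w))
  split_ifs
  exacts [le_rfl, h0 p q]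

theorem elimCoeff_symm (hs : ∀ p q, c p q = c q p) (s p q : W) :
    elimCoeff c s p q = elimCoeff c s q p := by
  simp only [elimCoeff, hs p q, or_comm (a := p = s), mul_comm (starWeight c s p)]

theorem elimCoeff_eq_zero_of_row {p : W} (hp : ∀ q, c p q = 0) (hs : ∀ p q, c p q = c q p)
    (s q : W) : elimCoeff c s p q = 0 := by
  simp [elimCoeff, starWeight, hp, hs s p]

theorem elimCoeff_self (s q : W) : elimCoeff c s s q = 0 := by
  simp [elimCoeff, starWeight]

/-- Eliminating `s` completes the square in the value at `s`. -/
theorem quadEnergy_eq_elimCoeff (h0 : ∀ p q, 0 ≤ c p q) (hs : ∀ p q, c p q = c q p) (s : W)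
    (u : W → ℝ) :
    quadEnergy c u = quadEnergy (elimCoeff c s) u + 2 * (∑ w, starWeight c s w) *
      (u s - (∑ q, starWeight c s q * u q) / ∑ w, starWeight c s w) ^ 2 := by
  have hsplit : quadEnergy c u =
      quadEnergy (fun p q => if p = s ∨ q = s then 0 else c p q) u +
        2 * ∑ q, starWeight c s q * (u s - u q) ^ 2 := by
    have hpt : ∀ p q, c p q * (u p - u q) ^ 2 =
        (if p = s ∨ q = s then 0 else c p q) * (u p - u q) ^ 2 +
          (if p = s then starWeight c s q * (u s - u q) ^ 2 else 0) +
          (if q = s then starWeight c s p * (u s - u p) ^ 2 else 0) := by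
      intro p q
      by_cases hp : p = s <;> by_cases hq : q = s
      · simp [hp, hq]
      · simp [hp, hq, starWeight]
      · simp only [hp, hq, starWeight, hs p s]
        simp
        left
        ring
      · simp [hp, hq]
    simp only [quadEnergy]
    simp_rw [hpt, Finset.sum_add_distrib]
    have h1 : ∑ p, ∑ q, (if p = s then starWeight c s q * (u s - u q) ^ 2 else 0) =
        ∑ q, starWeight c s q * (u s - u q) ^ 2 := by
      rw [Finset.sum_comm]; simp
    have h2 : ∑ p, ∑ q, (if q = s then starWeight c s p * (u s - u p) ^ 2 else 0) =
        ∑ q, starWeight c s q * (u s - u q) ^ 2 := by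
      simp
    rw [h1, h2]
    ring
  rw [hsplit, star_mesh_identity _ _ (starWeight_nonneg h0 s), ← add_assoc]
  congr 1
  simp only [quadEnergy, elimCoeff, add_mul, Finset.sum_add_distrib]

theorem quadEnergy_congr {S : Finset W} (hs : ∀ p q, c p q = c q p)
    (hS : ∀ p ∈ S, ∀ q, c p q = 0) {u v : W → ℝ} (huv : ∀ p, p ∉ S → v p = u p) :
    quadEnergy c v = quadEnergy c u := by
  refine Finset.sum_congr rfl fun p _ => Finset.sum_congr rfl fun q _ => ?_
  by_cases hp : p ∈ S
  · simp [hS p hp]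
  by_cases hq : q ∈ S
  · simp [hs p q, hS q hq]
  rw [huv p hp, huv q hq]

/-- The trace of a Dirichlet form on the complement of `S` is a Dirichlet form, and the minimum
defining it is attained. -/
theorem exists_trace_coeff (h0 : ∀ p q, 0 ≤ c p q) (hs : ∀ p q, c p q = c q p) (S : Finset W) :
    ∃ c' : W → W → ℝ, (∀ p q, 0 ≤ c' p q) ∧ (∀ p q, c' p q = c' q p) ∧
      (∀ p ∈ S, ∀ q, c' p q = 0) ∧
      ∀ u : W → ℝ, IsLeast {x | ∃ v : W → ℝ, (∀ p, p ∉ S → v p = u p) ∧ quadEnergy c v = x}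
        (quadEnergy c' u) := by
  induction S using Finset.induction_on with
  | empty =>
    refine ⟨c, h0, hs, by simp, fun u => ⟨⟨u, fun _ _ => rfl, rfl⟩, ?_⟩⟩
    rintro x ⟨v, hv, rfl⟩
    rw [show v = u from funext fun p => hv p (Finset.notMem_empty p)]
  | insert s S hsS ih =>
    obtain ⟨c', h0', hs', hS', hmin⟩ := ih
    have hzero : ∀ p ∈ insert s S, ∀ q, elimCoeff c' s p q = 0 := by
      intro p hp q
      rcases Finset.mem_insert.1 hp with rfl | hp
      · exact elimCoeff_self p q
      · exact elimCoeff_eq_zero_of_row (hS' p hp) hs' s q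
    refine ⟨elimCoeff c' s, elimCoeff_nonneg h0' s, elimCoeff_symm hs' s, hzero, fun u => ⟨?_, ?_⟩⟩
    · set m := (∑ q, starWeight c' s q * u q) / ∑ w, starWeight c' s w with hm
      obtain ⟨v, hv, hval⟩ := (hmin (Function.update u s m)).1
      have hup : ∀ p, p ∉ insert s S → Function.update u s m p = u p := fun p hp =>
        Function.update_of_ne (ne_of_mem_of_not_mem (Finset.mem_insert_self s S) hp).symm _ _
      refine ⟨v, fun p hp => ?_, ?_⟩
      · rw [hv p fun h => hp (Finset.mem_insert_of_mem h), hup p hp]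
      · have hmean : ∑ q, starWeight c' s q * Function.update u s m q =
            ∑ q, starWeight c' s q * u q := by
          refine Finset.sum_congr rfl fun q _ => ?_
          by_cases hq : q = s
          · simp [hq, starWeight]
          · rw [Function.update_of_ne hq]
        rw [hval, quadEnergy_eq_elimCoeff h0' hs' s, hmean, ← hm, Function.update_self, sub_self,
          quadEnergy_congr (elimCoeff_symm hs' s) hzero hup]
        ring
    · rintro x ⟨v, hv, rfl⟩
      calc quadEnergy (elimCoeff c' s) u = quadEnergy (elimCoeff c' s) v :=
            (quadEnergy_congr (elimCoeff_symm hs' s) hzero hv).symm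
        _ ≤ quadEnergy c' v := by
            rw [quadEnergy_eq_elimCoeff h0' hs' s v]
            exact le_add_of_nonneg_right (mul_nonneg (mul_nonneg zero_le_two
              (Finset.sum_nonneg fun w _ => starWeight_nonneg h0' s w)) (sq_nonneg _))
        _ ≤ quadEnergy c v := (hmin v).2 ⟨v, fun _ _ => rfl, rfl⟩

end Elimination

/-- `S_{1,r}(E)` is a Dirichlet form on `V¹`. -/
theorem S1r_isDirichletForm (F : FractalTriple N k V1) (r : Fin k → ℝ) (hr : ∀ i, 0 ≤ r i)
    (E : (Fin N → ℝ) → ℝ) (hE : IsDirichletForm E) : IsDirichletForm (S1r F r E) := by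
  classical
  obtain ⟨c, h0, hs, hc⟩ := hE
  refine ⟨fun x y => ∑ i, ∑ p, ∑ q, if F.ψ i p = x ∧ F.ψ i q = y then r i * c p q else 0,
    fun x y => ?_, fun x y => ?_, fun v => ?_⟩
  · refine Finset.sum_nonneg fun i _ => Finset.sum_nonneg fun p _ => Finset.sum_nonneg fun q _ => ?_
    split_ifs
    exacts [mul_nonneg (hr i) (h0 p q), le_rfl]
  · refine Finset.sum_congr rfl fun i _ => ?_
    rw [Finset.sum_comm]
    refine Finset.sum_congr rfl fun p _ => Finset.sum_congr rfl fun q _ => ?_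
    simp only [hs q p, and_comm]
  · have hedge : ∀ i p q, ∑ x, ∑ y,
        (if F.ψ i p = x ∧ F.ψ i q = y then r i * c p q else 0) * (v x - v y) ^ 2 =
          r i * c p q * (v (F.ψ i p) - v (F.ψ i q)) ^ 2 := by
      intro i p q
      simp [ite_and, ite_mul]
    simp only [S1r, hc, Finset.mul_sum, Finset.sum_mul, ← mul_assoc, ← hedge]
    simp_rw [Finset.sum_comm (s := (Finset.univ : Finset V1)) (t := (Finset.univ : Finset (Fin k))),
      Finset.sum_comm (s := (Finset.univ : Finset V1)) (t := (Finset.univ : Finset (Fin N)))]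

/-- `Λ_r(E)` is again a Dirichlet form on `V⁰`. -/
theorem Lam_isDirichletForm (F : FractalTriple N k V1)
    (r : Fin k → ℝ) (hr : ∀ i, 0 < r i)
    (E : (Fin N → ℝ) → ℝ) (hE : IsDirichletForm E) :
    IsDirichletForm (Lam F r E) := by
  classical
  obtain ⟨c, h0, hs, hc⟩ := S1r_isDirichletForm F r (fun i => (hr i).le) E hE
  obtain ⟨c', h0', hs', hS', hmin⟩ :=
    exists_trace_coeff h0 hs (Finset.univ.filter fun x => x ∉ Set.range F.P)
  refine ⟨fun p q => c' (F.P p) (F.P q), fun p q => h0' _ _, fun p q => hs' _ _, fun u => ?_⟩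
  set U : V1 → ℝ := Function.extend F.P u 0 with hU
  have hUP : ∀ j, U (F.P j) = u j := fun j => F.P_inj.extend_apply u 0 j
  have hset : {x : ℝ | ∃ v : V1 → ℝ, (∀ j, v (F.P j) = u j) ∧ S1r F r E v = x} =
      {x | ∃ v : V1 → ℝ, (∀ p, p ∉ Finset.univ.filter (fun x => x ∉ Set.range F.P) → v p = U p) ∧
        quadEnergy c v = x} := by
    ext x
    refine exists_congr fun v => and_congr ?_ (by rw [hc, quadEnergy])
    simp [hUP]
  have hrange : ∀ f : V1 → ℝ, (∀ x, x ∉ Set.range F.P → f x = 0) → ∑ x, f x = ∑ p, f (F.P p) :=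
    fun f hf => (Fintype.sum_of_injective F.P F.P_inj _ _ hf fun _ => rfl).symm
  rw [Lam, hset, (hmin U).csInf_eq, quadEnergy, hrange]
  · refine Finset.sum_congr rfl fun p _ => ?_
    rw [hrange]
    · simp only [hUP]
    · intro y hy
      rw [hs', hS' y (by simpa using hy), zero_mul]
  · intro x hx
    exact Finset.sum_eq_zero fun y _ => by rw [hS' x (by simpa using hx), zero_mul]
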